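/- Let k ≥ 2 be an integer and let f be smooth (C^∞) on the square K̂ = [−1,1]². Then the Q^k M-type projection remainder is orthogonal on K̂ to every polynomial in Q^{k−2}(K̂): ∬_{[−1,1]²} (f(s,t) − f_{k,k}(s,t)) s^m t^n ds dt = 0 for all integers 0 ≤ m, n ≤ k−2. -/

import Mathlib

open intervalIntegral

/-- The Legendre polynomial `l_j(t) = (1/(2^j j!)) (d/dt)^j (t²−1)^j`. -/
noncomputable def legendreP (j : ℕ) (t : ℝ) : ℝ :=
  (1 / (2 ^ j * (Nat.factorial j : ℝ))) * iteratedDeriv j (fun x : ℝ => (x ^ 2 - 1) ^ j) t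

/-- The M-type polynomials: `M_0(t) = 1`, `M_1(t) = t`, and
    `M_{k+1}(t) = (1/(2^k k!)) (d/dt)^{k−1} (t²−1)^k` for `k ≥ 1`. -/
noncomputable def Mpoly : ℕ → ℝ → ℝ
  | 0, _ => 1
  | 1, t => t
  | (k + 2), t =>
      (1 / (2 ^ (k + 1) * (Nat.factorial (k + 1) : ℝ))) *
        iteratedDeriv k (fun x : ℝ => (x ^ 2 - 1) ^ (k + 1)) t

/-- The 2D M-type coefficients `b_{i,j}` of a function `f` on `[−1,1]²`. -/
noncomputable def mcoeff2 (f : ℝ → ℝ → ℝ) : ℕ → ℕ → ℝ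
  | 0, 0 => (f (-1) (-1) + f (-1) 1 + f 1 (-1) + f 1 1) / 4
  | 0, (j + 1) => ((2 * ((j : ℝ) + 1) - 1) / 4) *
      ∫ t in (-1:ℝ)..1, (deriv (f 1) t + deriv (f (-1)) t) * legendreP j t
  | (i + 1), 0 => ((2 * ((i : ℝ) + 1) - 1) / 4) *
      ∫ s in (-1:ℝ)..1,
        (deriv (fun x => f x 1) s + deriv (fun x => f x (-1)) s) * legendreP i s
  | (i + 1), (j + 1) => ((2 * ((i : ℝ) + 1) - 1) * (2 * ((j : ℝ) + 1) - 1) / 4) *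
      ∫ s in (-1:ℝ)..1, ∫ t in (-1:ℝ)..1,
        deriv (fun x => deriv (f x) t) s * legendreP i s * legendreP j t

/-- The `Q^k` M-type projection `f_{k,k}(s,t) = Σ_{i=0}^{k} Σ_{j=0}^{k} b_{i,j} M_i(s) M_j(t)`. -/
noncomputable def mproj2 (f : ℝ → ℝ → ℝ) (k : ℕ) (s t : ℝ) : ℝ :=
  ∑ i ∈ Finset.range (k + 1), ∑ j ∈ Finset.range (k + 1),
    mcoeff2 f i j * Mpoly i s * Mpoly j t

open Polynomial

/-- The Legendre polynomial of degree `j`, as an element of `ℝ[X]`. -/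
noncomputable def legendrePoly (j : ℕ) : ℝ[X] :=
  C (1 / (2 ^ j * (Nat.factorial j : ℝ))) * derivative^[j] ((X ^ 2 - 1) ^ j)

/-- The M-type polynomial of degree `j`, as an element of `ℝ[X]`. -/
noncomputable def mTypePoly : ℕ → ℝ[X]
  | 0 => 1
  | 1 => X
  | (k + 2) => C (1 / (2 ^ (k + 1) * (Nat.factorial (k + 1) : ℝ))) *
      derivative^[k] ((X ^ 2 - 1) ^ (k + 1))

theorem iteratedDeriv_eval (p : ℝ[X]) (n : ℕ) :
    iteratedDeriv n (fun x => p.eval x) = fun x => (derivative^[n] p).eval x := by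
  induction n with
  | zero => simp
  | succ n ih =>
    rw [iteratedDeriv_succ, ih, Function.iterate_succ_apply']
    funext x
    exact Polynomial.deriv _

theorem iteratedDeriv_sq_sub_one_pow (n j : ℕ) (t : ℝ) :
    iteratedDeriv n (fun x : ℝ => (x ^ 2 - 1) ^ j) t
      = (derivative^[n] ((X ^ 2 - 1 : ℝ[X]) ^ j)).eval t := by
  have h := congrFun (iteratedDeriv_eval ((X ^ 2 - 1) ^ j) n) t
  simpa using h

theorem legendreP_eq_eval (j : ℕ) : legendreP j = fun t => (legendrePoly j).eval t := by
  funext t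
  simp only [legendreP, legendrePoly, iteratedDeriv_sq_sub_one_pow, eval_mul, eval_C]

theorem Mpoly_eq_eval (j : ℕ) : Mpoly j = fun t => (mTypePoly j).eval t := by
  funext t
  match j with
  | 0 => simp [Mpoly, mTypePoly]
  | 1 => simp [Mpoly, mTypePoly]
  | k + 2 => simp only [Mpoly, mTypePoly, iteratedDeriv_sq_sub_one_pow, eval_mul, eval_C]

theorem derivative_mTypePoly_succ (j : ℕ) : derivative (mTypePoly (j + 1)) = legendrePoly j := by
  match j with
  | 0 => simp [mTypePoly, legendrePoly]
  | k + 1 => simp only [mTypePoly, legendrePoly, derivative_C_mul, Function.iterate_succ_apply']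

theorem eval_iterate_derivative_sq_sub_one_pow {a j : ℕ} (h : a < j) {x : ℝ} (hx : x ^ 2 = 1) :
    (derivative^[a] ((X ^ 2 - 1 : ℝ[X]) ^ j)).eval x = 0 := by
  obtain ⟨q, hq⟩ := pow_sub_dvd_iterate_derivative_pow (X ^ 2 - 1 : ℝ[X]) j a
  rw [hq]
  simp [hx, Nat.sub_ne_zero_of_lt h]

theorem contDiff_eval (p : ℝ[X]) {n : WithTop ℕ∞} : ContDiff ℝ n (fun x => p.eval x) := by
  simpa using p.contDiff_aeval (𝕜 := ℝ) n

theorem integral_mul_eval_derivative {g : ℝ → ℝ} (hg : ContDiff ℝ 1 g) (q : ℝ[X]) :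
    ∫ t in (-1:ℝ)..1, g t * (derivative q).eval t
      = g 1 * q.eval 1 - g (-1) * q.eval (-1) - ∫ t in (-1:ℝ)..1, deriv g t * q.eval t := by
  refine intervalIntegral.integral_mul_deriv_eq_deriv_mul (u := g) (u' := deriv g)
    (v := fun t => q.eval t) (v' := fun t => (derivative q).eval t) ?_ ?_ ?_ ?_
  · intro x _
    exact (hg.differentiable one_ne_zero x).hasDerivAt
  · intro x _
    exact q.hasDerivAt x
  · exact (hg.continuous_deriv le_rfl).intervalIntegrable _ _
  · exact (derivative q).continuous.intervalIntegrable _ _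

theorem integral_iterate_derivative_sq_sub_one_pow_mul {a j : ℕ} (h : a ≤ j) (q : ℝ[X]) :
    ∫ t in (-1:ℝ)..1, (derivative^[a] ((X ^ 2 - 1 : ℝ[X]) ^ j)).eval t * q.eval t
      = (-1) ^ a * ∫ t in (-1:ℝ)..1, (t ^ 2 - 1) ^ j * (derivative^[a] q).eval t := by
  induction a generalizing q with
  | zero => simp
  | succ a ih =>
    have hp := integral_mul_eval_derivative
      (contDiff_eval (derivative^[a] ((X ^ 2 - 1 : ℝ[X]) ^ j))) q
    simp only [Polynomial.deriv] at hp
    rw [eval_iterate_derivative_sq_sub_one_pow h (by norm_num),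
      eval_iterate_derivative_sq_sub_one_pow h (by norm_num), ih (by omega)] at hp
    rw [Function.iterate_succ_apply', Function.iterate_succ_apply, pow_succ (-1 : ℝ) a]
    linarith

theorem natDegree_sq_sub_one_pow (j : ℕ) : ((X ^ 2 - 1 : ℝ[X]) ^ j).natDegree = j * 2 := by
  rw [natDegree_pow, show (1 : ℝ[X]) = C 1 from rfl, natDegree_X_pow_sub_C]

theorem coeff_sq_sub_one_pow (j : ℕ) : ((X ^ 2 - 1 : ℝ[X]) ^ j).coeff (j * 2) = 1 := by
  have h : (X ^ 2 - 1 : ℝ[X]).Monic := monic_X_pow_sub_C 1 two_ne_zero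
  rw [← natDegree_sq_sub_one_pow]
  exact (h.pow j).coeff_natDegree

theorem natDegree_legendrePoly_le (j : ℕ) : (legendrePoly j).natDegree ≤ j := by
  refine (natDegree_C_mul_le _ _).trans ((natDegree_iterate_derivative _ _).trans ?_)
  rw [natDegree_sq_sub_one_pow]
  omega

theorem coeff_legendrePoly_ne_zero (j : ℕ) : (legendrePoly j).coeff j ≠ 0 := by
  rw [legendrePoly, coeff_C_mul, coeff_iterate_derivative, ← mul_two, coeff_sq_sub_one_pow]
  have : (j * 2).descFactorial j ≠ 0 := by
    rw [Ne, Nat.descFactorial_eq_zero_iff_lt]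
    omega
  simp [this, Nat.factorial_ne_zero]

theorem integral_legendrePoly_mul_of_natDegree_lt {j : ℕ} {q : ℝ[X]} (h : q.natDegree < j) :
    ∫ t in (-1:ℝ)..1, (legendrePoly j).eval t * q.eval t = 0 := by
  simp only [legendrePoly, eval_mul, eval_C, mul_assoc]
  rw [intervalIntegral.integral_const_mul, integral_iterate_derivative_sq_sub_one_pow_mul le_rfl,
    iterate_derivative_eq_zero h]
  simp

theorem integral_sq_sub_one_pow_succ (j : ℕ) :
    (2 * (j : ℝ) + 3) * ∫ t in (-1:ℝ)..1, (t ^ 2 - 1) ^ (j + 1)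
      = -(2 * ((j : ℝ) + 1) * ∫ t in (-1:ℝ)..1, (t ^ 2 - 1) ^ j) := by
  have h := integral_mul_eval_derivative (contDiff_eval ((X ^ 2 - 1 : ℝ[X]) ^ (j + 1))) X
  simp only [Polynomial.deriv, derivative_X, eval_one, mul_one] at h
  have e : ∀ t : ℝ, (derivative ((X ^ 2 - 1 : ℝ[X]) ^ (j + 1))).eval t * (X : ℝ[X]).eval t
      = 2 * ((j : ℝ) + 1) * (t ^ 2 - 1) ^ (j + 1) + 2 * ((j : ℝ) + 1) * (t ^ 2 - 1) ^ j := by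
    intro t
    simp [derivative_pow]
    ring
  simp only [e] at h
  rw [intervalIntegral.integral_add (Continuous.intervalIntegrable (by fun_prop) _ _)
    (Continuous.intervalIntegrable (by fun_prop) _ _), intervalIntegral.integral_const_mul,
    intervalIntegral.integral_const_mul] at h
  simp at h
  linarith

theorem integral_sq_sub_one_pow (j : ℕ) :
    ((2 * j + 1).factorial : ℝ) * ∫ t in (-1:ℝ)..1, (t ^ 2 - 1) ^ j
      = (-1) ^ j * 2 * (2 ^ j * (j.factorial : ℝ)) ^ 2 := by
  induction j with
  | zero => norm_num
  | succ j ih =>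
    have h := integral_sq_sub_one_pow_succ j
    rw [show 2 * (j + 1) + 1 = (2 * j + 1) + 1 + 1 by ring, Nat.factorial_succ (2 * j + 1 + 1),
      Nat.factorial_succ (2 * j + 1), Nat.factorial_succ j]
    push_cast
    linear_combination (2 * (j : ℝ) + 2) * ((2 * j + 1).factorial : ℝ) * h
      - (2 * (j : ℝ) + 2) ^ 2 * ih

theorem integral_legendrePoly_sq (j : ℕ) :
    (2 * (j : ℝ) + 1) / 2 * ∫ t in (-1:ℝ)..1, (legendrePoly j).eval t * (legendrePoly j).eval t
      = 1 := by
  have hD : derivative^[j] (legendrePoly j)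
      = C (1 / (2 ^ j * (j.factorial : ℝ)) * ((2 * j).factorial : ℝ)) := by
    have h0 : (derivative^[j] (derivative^[j] ((X ^ 2 - 1 : ℝ[X]) ^ j))).natDegree = 0 := by
      rw [← Function.iterate_add_apply, ← Nat.le_zero]
      refine (natDegree_iterate_derivative _ _).trans ?_
      rw [natDegree_sq_sub_one_pow]
      omega
    rw [legendrePoly, iterate_derivative_C_mul, eq_C_of_natDegree_eq_zero h0,
      ← Function.iterate_add_apply, coeff_iterate_derivative, zero_add, ← two_mul, mul_comm 2 j,
      coeff_sq_sub_one_pow, Nat.descFactorial_self, ← C_mul]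
    simp
  have h2 : ∫ t in (-1:ℝ)..1, (legendrePoly j).eval t * (legendrePoly j).eval t
      = 1 / (2 ^ j * (j.factorial : ℝ)) *
        ∫ t in (-1:ℝ)..1, (derivative^[j] ((X ^ 2 - 1 : ℝ[X]) ^ j)).eval t *
          (legendrePoly j).eval t := by
    rw [← intervalIntegral.integral_const_mul]
    simp only [legendrePoly, eval_mul, eval_C, mul_assoc]
  rw [h2, integral_iterate_derivative_sq_sub_one_pow_mul le_rfl, hD]
  simp only [eval_C]
  rw [intervalIntegral.integral_mul_const]
  have h := integral_sq_sub_one_pow j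
  rw [Nat.factorial_succ] at h
  have hf : (j.factorial : ℝ) ≠ 0 := by exact_mod_cast j.factorial_ne_zero
  have hs : ((-1 : ℝ) ^ j) * (-1) ^ j = 1 := by rw [← mul_pow]; simp
  push_cast at h
  field_simp
  linear_combination (-1 : ℝ) ^ j * h + 2 * (2 ^ j * (j.factorial : ℝ)) ^ 2 * hs

theorem integral_legendrePoly_mul (i j : ℕ) :
    (2 * (i : ℝ) + 1) / 2 * ∫ t in (-1:ℝ)..1, (legendrePoly j).eval t * (legendrePoly i).eval t
      = if i = j then 1 else 0 := by
  rcases lt_trichotomy i j with h | rfl | h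
  · rw [integral_legendrePoly_mul_of_natDegree_lt ((natDegree_legendrePoly_le i).trans_lt h),
      if_neg h.ne, mul_zero]
  · rw [integral_legendrePoly_sq, if_pos rfl]
  · simp only [mul_comm ((legendrePoly j).eval _)]
    rw [integral_legendrePoly_mul_of_natDegree_lt ((natDegree_legendrePoly_le j).trans_lt h),
      if_neg h.ne', mul_zero]

theorem exists_eq_sum_legendrePoly (k : ℕ) (p : ℝ[X]) (hp : p.degree < k) :
    ∃ c : ℕ → ℝ, p = ∑ i ∈ Finset.range k, C (c i) * legendrePoly i := by
  induction k generalizing p with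
  | zero => exact ⟨0, by simpa [Nat.WithBot.lt_zero_iff] using hp⟩
  | succ k ih =>
    set a := p.coeff k / (legendrePoly k).coeff k with ha
    obtain ⟨c, hc⟩ := ih (p - C a * legendrePoly k) (by
      rw [degree_lt_iff_coeff_zero] at hp ⊢
      intro m hm
      rw [coeff_sub, coeff_C_mul]
      rcases hm.eq_or_lt with rfl | hm
      · rw [ha, div_mul_cancel₀ _ (coeff_legendrePoly_ne_zero k), sub_self]
      · rw [hp m hm, coeff_eq_zero_of_natDegree_lt ((natDegree_legendrePoly_le k).trans_lt hm)]
        simp)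
    refine ⟨Function.update c k a, ?_⟩
    rw [Finset.sum_range_succ, Function.update_self, ← sub_eq_iff_eq_add, hc]
    refine Finset.sum_congr rfl fun i hi => ?_
    rw [Function.update_of_ne (Finset.mem_range.mp hi).ne]

/-- The M-type coefficients of a function of one variable. -/
noncomputable def mcoeff (g : ℝ → ℝ) : ℕ → ℝ
  | 0 => (g 1 + g (-1)) / 2
  | (j + 1) => (2 * (j : ℝ) + 1) / 2 * ∫ t in (-1:ℝ)..1, deriv g t * legendreP j t

theorem mcoeff_Mpoly (i j : ℕ) : mcoeff (Mpoly j) i = if i = j then 1 else 0 := by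
  rw [Mpoly_eq_eval]
  match i, j with
  | 0, 0 => simp [mcoeff, mTypePoly]
  | 0, 1 => simp [mcoeff, mTypePoly]
  | 0, k + 2 =>
    simp [mcoeff, mTypePoly, eval_iterate_derivative_sq_sub_one_pow (Nat.lt_succ_self k)]
  | i + 1, 0 => simp [mcoeff, mTypePoly]
  | i + 1, j + 1 =>
    simp only [mcoeff, Polynomial.deriv, derivative_mTypePoly_succ, legendreP_eq_eval,
      integral_legendrePoly_mul, Nat.succ_inj]

theorem contDiff_Mpoly (j : ℕ) : ContDiff ℝ 1 (Mpoly j) := by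
  rw [Mpoly_eq_eval]
  exact contDiff_eval _

theorem continuous_legendreP (j : ℕ) : Continuous (legendreP j) := by
  rw [legendreP_eq_eval]
  exact (legendrePoly j).continuous

theorem exists_moment_eq_sum_mcoeff {k m : ℕ} (hm : m + 2 ≤ k) :
    ∃ c : ℕ → ℝ, ∀ g : ℝ → ℝ, ContDiff ℝ 1 g →
      ∫ t in (-1:ℝ)..1, g t * t ^ m = ∑ i ∈ Finset.range (k + 1), c i * mcoeff g i := by
  obtain ⟨p, hp, hp1, hpd⟩ :
      ∃ p : ℝ[X], derivative p = X ^ m ∧ p.eval (-1) = -p.eval 1 ∧ p.degree < k := by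
    refine ⟨C (1 / ((m : ℝ) + 1)) * X ^ (m + 1)
      - C (1 / ((m : ℝ) + 1) * (1 + (-1) ^ (m + 1)) / 2), ?_, ?_, ?_⟩
    · have : (m : ℝ) + 1 ≠ 0 := by positivity
      rw [derivative_sub, derivative_C, sub_zero, derivative_C_mul_X_pow, Nat.add_sub_cancel]
      push_cast
      rw [one_div_mul_cancel this, C_1, one_mul]
    · simp only [eval_sub, eval_mul, eval_C, eval_pow, eval_X, one_pow]
      ring
    · refine (degree_sub_le _ _).trans_lt (max_lt ?_ ?_)
      · exact (degree_C_mul_X_pow_le _ _).trans_lt (by exact_mod_cast hm)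
      · exact degree_C_le.trans_lt (by exact_mod_cast (by omega : 0 < k))
  obtain ⟨d, hd⟩ := exists_eq_sum_legendrePoly k p hpd
  refine ⟨fun i => Nat.casesOn i (2 * p.eval 1) fun i => -(d i * (2 / (2 * (i : ℝ) + 1))), ?_⟩
  intro g hg
  have h := integral_mul_eval_derivative hg p
  simp only [hp, eval_pow, eval_X, hp1] at h
  have hint : ∫ t in (-1:ℝ)..1, deriv g t * p.eval t
      = ∑ i ∈ Finset.range k, d i * ∫ t in (-1:ℝ)..1, deriv g t * legendreP i t := by
    simp only [← intervalIntegral.integral_const_mul]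
    rw [← intervalIntegral.integral_finsetSum]
    · congr 1
      funext t
      conv_lhs => rw [hd]
      simp only [eval_finsetSum, eval_mul, eval_C, legendreP_eq_eval, Finset.mul_sum]
      exact Finset.sum_congr rfl fun i _ => by ring
    · intro i _
      exact (continuous_const.mul ((hg.continuous_deriv le_rfl).mul
        (continuous_legendreP i))).intervalIntegrable _ _
  rw [h, hint, Finset.sum_range_succ', sub_eq_add_neg, add_comm, ← Finset.sum_neg_distrib]
  congr 1
  · refine Finset.sum_congr rfl fun i _ => ?_
    have : 2 * (i : ℝ) + 1 ≠ 0 := by positivity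
    simp only [mcoeff]
    field_simp
  · change _ = 2 * p.eval 1 * ((g 1 + g (-1)) / 2)
    ring

/-- The moments of order at most `k - 2` of a function agree with those of its M-type projection
of degree `k`. -/
theorem integral_mul_pow_eq_sum_mcoeff {k m : ℕ} (hm : m + 2 ≤ k) {g : ℝ → ℝ}
    (hg : ContDiff ℝ 1 g) :
    ∫ t in (-1:ℝ)..1, g t * t ^ m
      = ∑ i ∈ Finset.range (k + 1), mcoeff g i * ∫ t in (-1:ℝ)..1, Mpoly i t * t ^ m := by
  obtain ⟨c, hc⟩ := exists_moment_eq_sum_mcoeff hm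
  rw [hc g hg]
  refine Finset.sum_congr rfl fun i hi => ?_
  rw [hc _ (contDiff_Mpoly i)]
  simp only [mcoeff_Mpoly, mul_ite, mul_one, mul_zero, Finset.sum_ite_eq', hi, if_true]
  ring

section Parametric

open Function

variable {G : ℝ → ℝ → ℝ}

theorem hasDerivAt_left_of_contDiff (hG : ContDiff ℝ 1 (uncurry G)) (s t : ℝ) :
    HasDerivAt (fun x => G x t) (fderiv ℝ (uncurry G) (s, t) (1, 0)) s :=
  ((hG.differentiable one_ne_zero (s, t)).hasFDerivAt.comp_hasDerivAt s
    ((hasDerivAt_id s).prodMk (hasDerivAt_const s t)) :)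

theorem hasDerivAt_right_of_contDiff (hG : ContDiff ℝ 1 (uncurry G)) (s t : ℝ) :
    HasDerivAt (G s) (fderiv ℝ (uncurry G) (s, t) (0, 1)) t :=
  ((hG.differentiable one_ne_zero (s, t)).hasFDerivAt.comp_hasDerivAt t
    ((hasDerivAt_const t s).prodMk (hasDerivAt_id t)) :)

theorem continuous_uncurry_deriv_left (hG : ContDiff ℝ 1 (uncurry G)) :
    Continuous (uncurry fun s t => deriv (fun x => G x t) s) := by
  have h : (uncurry fun s t => deriv (fun x => G x t) s)
      = fun p => fderiv ℝ (uncurry G) p (1, 0) := by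
    funext p
    exact (hasDerivAt_left_of_contDiff hG p.1 p.2).deriv
  rw [h]
  exact (hG.continuous_fderiv one_ne_zero).clm_apply continuous_const

theorem contDiff_uncurry_deriv_right (hG : ContDiff ℝ 2 (uncurry G)) :
    ContDiff ℝ 1 (uncurry fun s t => deriv (G s) t) := by
  have h : (uncurry fun s t => deriv (G s) t) = fun p => fderiv ℝ (uncurry G) p (0, 1) := by
    funext p
    exact (hasDerivAt_right_of_contDiff (hG.of_le one_le_two) p.1 p.2).deriv
  rw [h]
  exact (hG.fderiv_right (m := 1) (by norm_num)).clm_apply contDiff_const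

theorem hasDerivAt_intervalIntegral_of_contDiff (hG : ContDiff ℝ 1 (uncurry G)) (a b s : ℝ) :
    HasDerivAt (fun x => ∫ t in a..b, G x t) (∫ t in a..b, deriv (fun x => G x t) s) s := by
  have hG' := continuous_uncurry_deriv_left hG
  obtain ⟨B, hB⟩ := ((isCompact_closedBall s 1).prod (isCompact_uIcc (a := a) (b := b)))
    |>.exists_bound_of_continuousOn hG'.continuousOn
  refine (intervalIntegral.hasDerivAt_integral_of_dominated_loc_of_deriv_le
    (F' := fun x t => deriv (fun x => G x t) x) (bound := fun _ => B)
    (Metric.closedBall_mem_nhds s one_pos) ?_ ?_ ?_ ?_ ?_ ?_).2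
  · exact .of_forall fun x => (hG.continuous.uncurry_left x).aestronglyMeasurable
  · exact (hG.continuous.uncurry_left s).intervalIntegrable _ _
  · exact (hG'.uncurry_left s).aestronglyMeasurable
  · exact .of_forall fun t ht x hx => hB (x, t) ⟨hx, Set.uIoc_subset_uIcc ht⟩
  · exact intervalIntegrable_const
  · exact .of_forall fun t _ x _ =>
      (hasDerivAt_left_of_contDiff hG x t).differentiableAt.hasDerivAt

theorem contDiff_intervalIntegral (hG : ContDiff ℝ 1 (uncurry G)) (a b : ℝ) :
    ContDiff ℝ 1 (fun x => ∫ t in a..b, G x t) := by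
  rw [contDiff_one_iff_deriv]
  refine ⟨fun s => (hasDerivAt_intervalIntegral_of_contDiff hG a b s).differentiableAt, ?_⟩
  rw [funext fun s => (hasDerivAt_intervalIntegral_of_contDiff hG a b s).deriv]
  exact intervalIntegral.continuous_parametric_intervalIntegral_of_continuous'
    (continuous_uncurry_deriv_left hG) a b

end Parametric

theorem contDiff_legendreP (j : ℕ) {n : WithTop ℕ∞} : ContDiff ℝ n (legendreP j) := by
  rw [legendreP_eq_eval]
  exact contDiff_eval _

theorem contDiff_uncurry_deriv_mul_legendreP {f : ℝ → ℝ → ℝ}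
    (hf : ContDiff ℝ 2 (Function.uncurry f)) (j : ℕ) :
    ContDiff ℝ 1 (Function.uncurry fun s t => deriv (f s) t * legendreP j t) :=
  (contDiff_uncurry_deriv_right hf).mul ((contDiff_legendreP j).comp contDiff_snd)

theorem contDiff_left {f : ℝ → ℝ → ℝ} {n : WithTop ℕ∞}
    (hf : ContDiff ℝ n (Function.uncurry f)) (t : ℝ) : ContDiff ℝ n fun s => f s t :=
  hf.comp (contDiff_id.prodMk contDiff_const)

theorem contDiff_right {f : ℝ → ℝ → ℝ} {n : WithTop ℕ∞}
    (hf : ContDiff ℝ n (Function.uncurry f)) (s : ℝ) : ContDiff ℝ n (f s) :=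
  hf.comp (contDiff_const.prodMk contDiff_id)

theorem contDiff_mcoeff {f : ℝ → ℝ → ℝ} (hf : ContDiff ℝ 2 (Function.uncurry f)) (j : ℕ) :
    ContDiff ℝ 1 fun s => mcoeff (f s) j := by
  cases j with
  | zero =>
    have hf1 := hf.of_le one_le_two
    exact ((contDiff_left hf1 1).add (contDiff_left hf1 (-1))).div_const 2
  | succ j =>
    exact contDiff_const.mul
      (contDiff_intervalIntegral (contDiff_uncurry_deriv_mul_legendreP hf j) _ _)

/-- The two-dimensional M-type coefficients are iterated one-dimensional ones. -/
theorem mcoeff2_eq_mcoeff {f : ℝ → ℝ → ℝ} (hf : ContDiff ℝ 2 (Function.uncurry f)) (i j : ℕ) :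
    mcoeff2 f i j = mcoeff (fun s => mcoeff (f s) j) i := by
  have hf1 := hf.of_le one_le_two
  match i, j with
  | 0, 0 =>
    simp only [mcoeff2, mcoeff]
    ring
  | 0, j + 1 =>
    have hint (s : ℝ) : IntervalIntegrable (fun t => deriv (f s) t * legendreP j t)
        MeasureTheory.volume (-1) 1 :=
      (((contDiff_right hf1 s).continuous_deriv le_rfl).mul
        (continuous_legendreP j)).intervalIntegrable _ _
    simp only [mcoeff2, mcoeff, add_mul]
    rw [intervalIntegral.integral_add (hint 1) (hint (-1))]
    ring
  | i + 1, 0 =>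
    have hd (s : ℝ) : deriv (fun x => (f x 1 + f x (-1)) / 2) s
        = (deriv (fun x => f x 1) s + deriv (fun x => f x (-1)) s) * (1 / 2) := by
      rw [deriv_div_const, deriv_fun_add ((contDiff_left hf1 1).differentiable one_ne_zero s)
        ((contDiff_left hf1 (-1)).differentiable one_ne_zero s)]
      ring
    simp only [mcoeff2, mcoeff, hd, mul_right_comm _ (1 / 2 : ℝ)]
    rw [intervalIntegral.integral_mul_const]
    ring
  | i + 1, j + 1 =>
    have hd (s : ℝ) := ((hasDerivAt_intervalIntegral_of_contDiff
      (contDiff_uncurry_deriv_mul_legendreP hf j) (-1) 1 s).const_mul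
        ((2 * (j : ℝ) + 1) / 2)).deriv
    simp only [deriv_mul_const_field] at hd
    simp only [mcoeff2, mcoeff, hd, mul_assoc, mul_left_comm _ (legendreP i _)]
    simp only [intervalIntegral.integral_const_mul]
    simp only [mul_comm (legendreP i _)]
    ring

/-- Let `k ≥ 2` and let `f` be smooth on `[−1,1]²`. Then the `Q^k` M-type
projection remainder is orthogonal on the square to every monomial `s^m t^n` with
`0 ≤ m, n ≤ k−2` (hence to every polynomial in `Q^{k−2}`). -/
theorem mproj2_remainder_orthogonal (k : ℕ) (hk : 2 ≤ k) (f : ℝ → ℝ → ℝ)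
    (hf : ContDiff ℝ (⊤ : ℕ∞) (Function.uncurry f))
    (m n : ℕ) (hm : m ≤ k - 2) (hn : n ≤ k - 2) :
    ∫ s in (-1:ℝ)..1, ∫ t in (-1:ℝ)..1,
      (f s t - mproj2 f k s t) * (s ^ m * t ^ n) = 0 := by
  have hf2 : ContDiff ℝ 2 (Function.uncurry f) := contDiff_infty.mp hf 2
  have hf1 := hf2.of_le one_le_two
  have hm' : m + 2 ≤ k := by omega
  have hn' : n + 2 ≤ k := by omega
  have hM (i : ℕ) : Continuous (Mpoly i) := (contDiff_Mpoly i).continuous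
  have inner (s : ℝ) : ∫ t in (-1:ℝ)..1, (f s t - mproj2 f k s t) * (s ^ m * t ^ n)
      = ∑ j ∈ Finset.range (k + 1), (mcoeff (f s) j * s ^ m
        - ∑ i ∈ Finset.range (k + 1), mcoeff2 f i j * (Mpoly i s * s ^ m)) *
          ∫ t in (-1:ℝ)..1, Mpoly j t * t ^ n := by
    have hc : IntervalIntegrable (fun t => s ^ m * (f s t * t ^ n)) MeasureTheory.volume (-1) 1 :=
      (continuous_const.mul ((contDiff_right hf1 s).continuous.mul
        (continuous_pow n))).intervalIntegrable _ _
    have hp (j : ℕ) (a : ℝ) : IntervalIntegrable (fun t => a * (Mpoly j t * t ^ n))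
        MeasureTheory.volume (-1) 1 :=
      (continuous_const.mul ((hM j).mul (continuous_pow n))).intervalIntegrable _ _
    have e (t : ℝ) : (f s t - mproj2 f k s t) * (s ^ m * t ^ n) = s ^ m * (f s t * t ^ n)
        - ∑ j ∈ Finset.range (k + 1),
          (∑ i ∈ Finset.range (k + 1), mcoeff2 f i j * (Mpoly i s * s ^ m)) *
            (Mpoly j t * t ^ n) := by
      rw [sub_mul, mproj2, Finset.sum_comm, Finset.sum_mul]
      congr 1
      · ring
      · refine Finset.sum_congr rfl fun j _ => ?_
        rw [Finset.sum_mul, Finset.sum_mul]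
        exact Finset.sum_congr rfl fun i _ => by ring
    simp only [e]
    rw [intervalIntegral.integral_sub hc (by
        simpa only [Finset.sum_fn] using IntervalIntegrable.sum _ fun j _ => hp j _),
      intervalIntegral.integral_finsetSum fun j _ => hp j _,
      intervalIntegral.integral_const_mul,
      integral_mul_pow_eq_sum_mcoeff hn' (contDiff_right hf1 s), Finset.mul_sum,
      ← Finset.sum_sub_distrib]
    refine Finset.sum_congr rfl fun j _ => ?_
    rw [intervalIntegral.integral_const_mul]
    ring
  simp only [inner]
  have hF (j : ℕ) : Continuous fun s => mcoeff (f s) j * s ^ m :=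
    (contDiff_mcoeff hf2 j).continuous.mul (continuous_pow m)
  have hS (i j : ℕ) : Continuous fun s => mcoeff2 f i j * (Mpoly i s * s ^ m) :=
    continuous_const.mul ((hM i).mul (continuous_pow m))
  have hT (j : ℕ) : Continuous fun s => ∑ i ∈ Finset.range (k + 1),
      mcoeff2 f i j * (Mpoly i s * s ^ m) := continuous_finsetSum _ fun i _ => hS i j
  rw [intervalIntegral.integral_finsetSum (f := fun j s => (mcoeff (f s) j * s ^ m
    - ∑ i ∈ Finset.range (k + 1), mcoeff2 f i j * (Mpoly i s * s ^ m)) *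
      ∫ t in (-1:ℝ)..1, Mpoly j t * t ^ n) fun j _ =>
    (((hF j).sub (hT j)).mul continuous_const).intervalIntegrable _ _]
  refine Finset.sum_eq_zero fun j _ => ?_
  rw [intervalIntegral.integral_mul_const,
    intervalIntegral.integral_sub ((hF j).intervalIntegrable _ _)
      ((hT j).intervalIntegrable _ _),
    intervalIntegral.integral_finsetSum fun i _ => (hS i j).intervalIntegrable _ _,
    integral_mul_pow_eq_sum_mcoeff hm' (contDiff_mcoeff hf2 j)]
  simp only [mcoeff2_eq_mcoeff hf2, intervalIntegral.integral_const_mul, sub_self, zero_mul]
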